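/- arXiv:2408.16764 — 5 statements merged into one kernel-verified Lean document; each statement's English description precedes it below -/
import Mathlib

section
/- There exists a finite set 𝒮 of Hermitian 3×3 complex matrices with the following property: for every nonempty measurable space Λ there is no map ε assigning to each O ∈ 𝒮 a measurable function ε(O) : Λ → ℝ such that ε(g(O)) = g ∘ ε(O) whenever O ∈ 𝒮, g : ℝ → ℝ, and g(O) ∈ 𝒮. That is, there exist finite sets of observables on ℂ³ admitting no classical embedding satisfying the Kochen–Specker noncontextuality condition. -/
open Matrix

universe u

/-- The space of 3×3 complex matrices. -/
abbrev M3 := Matrix (Fin 3) (Fin 3) ℂ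

section Colouring

variable {α : Type*}

/-- Exactly one member of the triple `t` has the value `1`, and the other two have the value `0`. -/
def IsOneHot (f : α → ℝ) (t : α × α × α) : Prop :=
  (f t.1 = 1 ∧ f t.2.1 = 0 ∧ f t.2.2 = 0) ∨ (f t.2.1 = 1 ∧ f t.1 = 0 ∧ f t.2.2 = 0) ∨
    (f t.2.2 = 1 ∧ f t.1 = 0 ∧ f t.2.1 = 0)

variable [DecidableEq α]

/-- Backtracking search for a `0`-`1` valuation that is one-hot on every triple of a list, takes the
value `1` on `ones` and the value `0` on `zeros`. -/
def colourable : List (α × α × α) → List α → List α → Bool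
  | [], _, _ => true
  | (u, v, w) :: ts, ones, zeros =>
    (!zeros.elem u && !ones.elem v && !ones.elem w && colourable ts (u :: ones) (v :: w :: zeros)) ||
    (!zeros.elem v && !ones.elem u && !ones.elem w && colourable ts (v :: ones) (u :: w :: zeros)) ||
    (!zeros.elem w && !ones.elem u && !ones.elem v && colourable ts (w :: ones) (u :: v :: zeros))

lemma colourable_of_isOneHot (f : α → ℝ) (ts : List (α × α × α)) (ones zeros : List α)
    (hts : ∀ t ∈ ts, IsOneHot f t) (h1 : ∀ a ∈ ones, f a = 1) (h0 : ∀ a ∈ zeros, f a = 0) :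
    colourable ts ones zeros = true := by
  induction ts generalizing ones zeros with
  | nil => rfl
  | cons t ts ih =>
    obtain ⟨u, v, w⟩ := t
    have notMem_zeros {a : α} (ha : f a = 1) : a ∉ zeros := fun h => by simp [h0 a h] at ha
    have notMem_ones {a : α} (ha : f a = 0) : a ∉ ones := fun h => by simp [h1 a h] at ha
    have step {a b c : α} (ha : f a = 1) (hb : f b = 0) (hc : f c = 0) :
        colourable ts (a :: ones) (b :: c :: zeros) = true :=
      ih _ _ (fun t ht => hts t (by simp [ht])) (by simpa [ha] using h1) (by simpa [hb, hc] using h0)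
    rcases hts (u, v, w) (by simp) with ⟨ha, hb, hc⟩ | ⟨ha, hb, hc⟩ | ⟨ha, hb, hc⟩ <;>
      simp [colourable, step ha hb hc, notMem_zeros ha, notMem_ones hb, notMem_ones hc]

end Colouring

section FunctionalCalculus

open Polynomial

variable {n : Type*} [Fintype n] [DecidableEq n]

lemma Matrix.IsHermitian.cfc_eval_polynomial {A : Matrix n n ℂ} (hA : A.IsHermitian) (q : ℝ[X]) :
    hA.cfc (fun x => q.eval x) = aeval A q := by
  rw [← hA.cfc_eq]
  exact cfc_polynomial q A hA

/-- A noncontextual valuation is one-hot on a resolution of the identity `P + Q + R = 1` into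
orthogonal projections, as soon as `0` and the observable `Q + 2 • R` are in its domain. -/
lemma isOneHot_of_noncontextual {S : Set (Matrix n n ℂ)} {v : Matrix n n ℂ → ℝ}
    (hv : ∀ O ∈ S, ∀ (hO : O.IsHermitian) (g : ℝ → ℝ), hO.cfc g ∈ S → v (hO.cfc g) = g (v O))
    {P Q R : Matrix n n ℂ} (h_sum : P + Q + R = 1) (hQ : Q * Q = Q) (hR : R * R = R)
    (hQR : Q * R = 0) (hRQ : R * Q = 0) (hO : (Q + (2 : ℝ) • R).IsHermitian)
    (h0S : 0 ∈ S) (hPS : P ∈ S) (hQS : Q ∈ S) (hRS : R ∈ S) (hOS : Q + (2 : ℝ) • R ∈ S) :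
    IsOneHot v (P, Q, R) := by
  have eval_eq {q : ℝ[X]} {B : Matrix n n ℂ} (hq : aeval (Q + (2 : ℝ) • R) q = B) (hB : B ∈ S) :
      v B = q.eval (v (Q + (2 : ℝ) • R)) := by
    have hcfc := (hO.cfc_eval_polynomial q).trans hq
    simpa only [hcfc] using hv _ hOS hO (fun x => q.eval x) (hcfc ▸ hB)
  have h_zero : v 0 = 0 := by
    have hz : (isHermitian_zero (n := n) (α := ℂ)).cfc (fun _ => 0) = 0 := by
      simpa using (isHermitian_zero (n := n) (α := ℂ)).cfc_eval_polynomial 0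
    simpa only [hz] using hv 0 h0S isHermitian_zero (fun _ => 0) (hz.symm ▸ h0S)
  have hP : P = 1 - Q - R := by rw [← h_sum]; abel
  have sq : (Q + (2 : ℝ) • R) ^ 2 = Q + (4 : ℝ) • R := by
    simp only [pow_two, add_mul, mul_add, smul_mul_assoc, mul_smul_comm, hQ, hR, hQR, hRQ]
    module
  have cube : (Q + (2 : ℝ) • R) ^ 3 = Q + (8 : ℝ) • R := by
    rw [pow_succ, sq]
    simp only [add_mul, mul_add, smul_mul_assoc, mul_smul_comm, hQ, hR, hQR, hRQ]
    module
  have vP : v P = _ := eval_eq (q := 1 - C (3 / 2) * X + C (1 / 2) * X ^ 2) (by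
    simp only [map_add, map_sub, map_mul, map_pow, map_one, aeval_X, aeval_C, sq, hP,
      ← Algebra.smul_def]
    module) hPS
  have vQ : v Q = _ := eval_eq (q := C 2 * X - X ^ 2) (by
    simp only [map_sub, map_mul, map_pow, aeval_X, aeval_C, sq, ← Algebra.smul_def]
    module) hQS
  have vR : v R = _ := eval_eq (q := C (1 / 2) * X ^ 2 - C (1 / 2) * X) (by
    simp only [map_sub, map_mul, map_pow, aeval_X, aeval_C, sq, ← Algebra.smul_def]
    module) hRS
  have v0 : v 0 = _ := eval_eq (q := X ^ 3 - C 3 * X ^ 2 + C 2 * X) (by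
    simp only [map_add, map_sub, map_mul, map_pow, aeval_X, aeval_C, sq, cube, ← Algebra.smul_def]
    module) h0S
  rw [h_zero] at v0
  unfold IsOneHot
  simp only [vP, vQ, vR]
  simp only [eval_add, eval_sub, eval_mul, eval_pow, eval_X, eval_C, eval_one] at v0 ⊢
  generalize v (Q + (2 : ℝ) • R) = x at v0
  have roots : x * ((x - 1) * (x - 2)) = 0 := by linear_combination -v0
  rcases mul_eq_zero.mp roots with hx | hx
  · left; subst hx; norm_num
  rcases mul_eq_zero.mp hx with hx | hx
  · right; left; rw [sub_eq_zero.mp hx]; norm_num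
  · right; right; rw [sub_eq_zero.mp hx]; norm_num

end FunctionalCalculus

section RayProjection

variable {n : Type*} [Fintype n]

/-- The orthogonal projection onto the line spanned by a nonzero integer vector. -/
noncomputable def rayProj (v : n → ℤ) : Matrix n n ℂ :=
  ((v ⬝ᵥ v : ℤ) : ℂ)⁻¹ • (vecMulVec v v).map (Int.cast : ℤ → ℂ)

lemma isHermitian_rayProj (v : n → ℤ) : (rayProj v).IsHermitian := by
  ext i j
  simp [rayProj, vecMulVec_apply, mul_comm]

lemma rayProj_mul_rayProj (u v : n → ℤ) :
    rayProj u * rayProj v = (((u ⬝ᵥ u : ℤ) : ℂ)⁻¹ * ((v ⬝ᵥ v : ℤ) : ℂ)⁻¹ * ((u ⬝ᵥ v : ℤ) : ℂ)) •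
      (vecMulVec u v).map (Int.cast : ℤ → ℂ) := by
  have h : (vecMulVec u u).map (Int.cast : ℤ → ℂ) * (vecMulVec v v).map (Int.cast : ℤ → ℂ) =
      ((u ⬝ᵥ v : ℤ) : ℂ) • (vecMulVec u v).map (Int.cast : ℤ → ℂ) := by
    change (vecMulVec u u).map (Int.castRingHom ℂ) * (vecMulVec v v).map (Int.castRingHom ℂ) = _
    rw [← Matrix.map_mul, vecMulVec_mul_vecMulVec]
    ext i j
    simp [vecMulVec_apply]
    ring
  rw [rayProj, rayProj, smul_mul_smul_comm, h, smul_smul]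

lemma rayProj_mul_self {v : n → ℤ} (hv : v ⬝ᵥ v ≠ 0) : rayProj v * rayProj v = rayProj v := by
  have hv' : ((v ⬝ᵥ v : ℤ) : ℂ) ≠ 0 := Int.cast_ne_zero.mpr hv
  rw [rayProj_mul_rayProj, inv_mul_cancel_right₀ hv', rayProj]

lemma rayProj_mul_eq_zero {u v : n → ℤ} (huv : u ⬝ᵥ v = 0) : rayProj u * rayProj v = 0 := by
  simp [rayProj_mul_rayProj, huv]

/-- The projections onto the rows of a square matrix with nonzero orthogonal rows sum to `1`. -/
lemma sum_rayProj_eq_one [DecidableEq n] {M : Matrix n n ℤ} {d : n → ℤ}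
    (hM : M * Mᵀ = diagonal d) (hd : ∀ i, d i ≠ 0) : ∑ i, rayProj (M i) = 1 := by
  have hdM (i : n) : M i ⬝ᵥ M i = d i := by
    simpa [Matrix.mul_apply'] using congr_fun (congr_fun hM i) i
  set N : Matrix n n ℂ := M.map (Int.castRingHom ℂ)
  have hN : N * Nᵀ = diagonal fun i => (d i : ℂ) := by
    rw [← Matrix.transpose_map, ← Matrix.map_mul, hM, diagonal_map (map_zero _)]
    rfl
  have h_inv : N * (Nᵀ * diagonal fun i => (d i : ℂ)⁻¹) = 1 := by
    rw [← mul_assoc, hN, diagonal_mul_diagonal, ← diagonal_one]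
    congr 1
    ext i
    exact mul_inv_cancel₀ (Int.cast_ne_zero.mpr (hd i))
  rw [← mul_eq_one_comm.mp h_inv]
  ext i j
  rw [Matrix.sum_apply, Matrix.mul_apply]
  refine Finset.sum_congr rfl fun k _ => ?_
  simp [rayProj, hdM, mul_diagonal, vecMulVec_apply, N]
  ring

end RayProjection

/-- Three nonzero, pairwise orthogonal integer vectors. -/
def IsOrthogonalTriad (t : (Fin 3 → ℤ) × (Fin 3 → ℤ) × (Fin 3 → ℤ)) : Prop :=
  t.1 ⬝ᵥ t.1 ≠ 0 ∧ t.2.1 ⬝ᵥ t.2.1 ≠ 0 ∧ t.2.2 ⬝ᵥ t.2.2 ≠ 0 ∧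
    t.1 ⬝ᵥ t.2.1 = 0 ∧ t.1 ⬝ᵥ t.2.2 = 0 ∧ t.2.1 ⬝ᵥ t.2.2 = 0

instance : DecidablePred IsOrthogonalTriad := fun t => by
  unfold IsOrthogonalTriad; infer_instance

lemma IsOrthogonalTriad.sum_rayProj {u v w : Fin 3 → ℤ} (h : IsOrthogonalTriad (u, v, w)) :
    rayProj u + rayProj v + rayProj w = 1 := by
  obtain ⟨hu, hv, hw, huv, huw, hvw⟩ := h
  have hM : Matrix.of ![u, v, w] * (Matrix.of ![u, v, w])ᵀ =
      diagonal ![u ⬝ᵥ u, v ⬝ᵥ v, w ⬝ᵥ w] := by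
    ext i j
    change ![u, v, w] i ⬝ᵥ ![u, v, w] j = _
    fin_cases i <;> fin_cases j <;>
      simp_all [dotProduct_comm v u, dotProduct_comm w u, dotProduct_comm w v]
  have := sum_rayProj_eq_one hM (by simp [Fin.forall_fin_succ, *])
  exact (Fin.sum_univ_three _).symm.trans this

/-- The 36 orthogonal bases, on 49 rays, of the Kochen–Specker configuration of Schütte and Bub. -/
def ksTriads : List ((Fin 3 → ℤ) × (Fin 3 → ℤ) × (Fin 3 → ℤ)) :=
  [(![0, 0, 1], ![1, -1, 0], ![1, 1, 0]),
   (![1, -1, 0], ![1, 1, -2], ![1, 1, 1]),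
   (![0, 0, 1], ![0, 1, 0], ![1, 0, 0]),
   (![0, 1, -2], ![0, 2, 1], ![1, 0, 0]),
   (![0, 2, 1], ![1, 1, -2], ![5, -1, 2]),
   (![1, -1, -1], ![1, -1, 2], ![1, 1, 0]),
   (![0, 2, 1], ![1, -1, 2], ![5, 1, -2]),
   (![1, -2, 1], ![1, 0, -1], ![1, 1, 1]),
   (![0, 1, 0], ![1, 0, -1], ![1, 0, 1]),
   (![1, -1, -1], ![1, 0, 1], ![1, 2, -1]),
   (![0, 1, -2], ![1, -2, -1], ![5, 2, 1]),
   (![1, -2, -1], ![1, 0, 1], ![1, 1, -1]),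
   (![1, -1, 0], ![1, 1, -1], ![1, 1, 2]),
   (![0, 1, -1], ![0, 1, 1], ![1, 0, 0]),
   (![0, 1, 1], ![1, 1, -1], ![2, -1, 1]),
   (![0, 1, -1], ![1, 1, 1], ![2, -1, -1]),
   (![0, 1, -1], ![1, -1, -1], ![2, 1, 1]),
   (![0, 1, 2], ![0, 2, -1], ![1, 0, 0]),
   (![0, 2, -1], ![1, 1, 2], ![5, -1, -2]),
   (![0, 1, 2], ![1, -2, 1], ![5, 2, -1]),
   (![0, 1, 2], ![1, 2, -1], ![5, -2, 1]),
   (![1, -1, -2], ![1, -1, 1], ![1, 1, 0]),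
   (![1, -1, 1], ![1, 0, -1], ![1, 2, 1]),
   (![0, 1, 1], ![1, -1, 1], ![2, 1, -1]),
   (![0, 1, -2], ![1, 2, 1], ![5, -2, -1]),
   (![0, 2, -1], ![1, -1, -2], ![5, 1, 2]),
   (![1, 0, 2], ![2, -5, -1], ![2, 1, -1]),
   (![0, 1, 0], ![1, 0, 2], ![2, 0, -1]),
   (![1, -1, 2], ![1, 5, 2], ![2, 0, -1]),
   (![1, -5, 2], ![1, 1, 2], ![2, 0, -1]),
   (![1, 0, 2], ![2, -1, -1], ![2, 5, -1]),
   (![1, 0, -2], ![2, -5, 1], ![2, 1, 1]),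
   (![1, 0, -2], ![2, -1, 1], ![2, 5, 1]),
   (![0, 1, 0], ![1, 0, -2], ![2, 0, 1]),
   (![1, -5, -2], ![1, 1, -2], ![2, 0, 1]),
   (![1, -1, -2], ![1, 5, -2], ![2, 0, 1])]

lemma isOrthogonalTriad_of_mem_ksTriads : ∀ t ∈ ksTriads, IsOrthogonalTriad t := by
  decide +kernel

lemma colourable_ksTriads : colourable ksTriads [] [] = false := by
  decide +kernel

/-- The observable with eigenvalues `0`, `1`, `2` along the three vectors of a triad. -/
noncomputable def triadObservable (t : (Fin 3 → ℤ) × (Fin 3 → ℤ) × (Fin 3 → ℤ)) : M3 :=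
  rayProj t.2.1 + (2 : ℝ) • rayProj t.2.2

lemma isHermitian_triadObservable (t : (Fin 3 → ℤ) × (Fin 3 → ℤ) × (Fin 3 → ℤ)) :
    (triadObservable t).IsHermitian :=
  (isHermitian_rayProj _).add ((isHermitian_rayProj _).smul (IsSelfAdjoint.all _))

/-- The zero matrix, the projections onto the rays of `ksTriads`, and the observables
diagonalised by the triads. -/
def ksObservables : Set M3 :=
  {O | O = 0 ∨ ∃ t ∈ ksTriads,
    O = rayProj t.1 ∨ O = rayProj t.2.1 ∨ O = rayProj t.2.2 ∨ O = triadObservable t}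

lemma finite_ksObservables : ksObservables.Finite := by
  have h : ksObservables ⊆ {0} ∪ ⋃ t ∈ {t | t ∈ ksTriads},
      {rayProj t.1, rayProj t.2.1, rayProj t.2.2, triadObservable t} := by
    intro O hO
    simpa [ksObservables] using hO
  refine Set.Finite.subset ?_ h
  exact (Set.finite_singleton _).union
    (ksTriads.finite_toSet.biUnion fun t _ => Set.toFinite _)

lemma isHermitian_of_mem_ksObservables {O : M3} (hO : O ∈ ksObservables) : O.IsHermitian := by
  rcases hO with rfl | ⟨t, -, rfl | rfl | rfl | rfl⟩
  · exact isHermitian_zero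
  · exact isHermitian_rayProj _
  · exact isHermitian_rayProj _
  · exact isHermitian_rayProj _
  · exact isHermitian_triadObservable t

/-- Kochen–Specker theorem. There exists a finite set `𝒮` of Hermitian
3×3 complex matrices admitting no classical embedding satisfying the Kochen–Specker
noncontextuality condition: for every nonempty measurable space `Λ` there is no map `ε`
assigning to each `O ∈ 𝒮` a measurable function `ε(O) : Λ → ℝ` such that
`ε(g(O)) = g ∘ ε(O)` whenever `O ∈ 𝒮`, `g : ℝ → ℝ` and `g(O) ∈ 𝒮`, where
`g(O) = Σ_k g(λ_k) p_k` is the functional calculus. -/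
theorem kochen_specker_finite :
    ∃ 𝒮 : Set M3, 𝒮.Finite ∧ (∀ O ∈ 𝒮, O.IsHermitian) ∧
      ∀ (Λ : Type u) [MeasurableSpace Λ] [Nonempty Λ],
        ¬ ∃ ε : M3 → Λ → ℝ,
          (∀ O ∈ 𝒮, Measurable (ε O)) ∧
          (∀ O ∈ 𝒮, ∀ (hO : O.IsHermitian) (g : ℝ → ℝ),
            hO.cfc g ∈ 𝒮 → ε (hO.cfc g) = g ∘ ε O) := by
  refine ⟨ksObservables, finite_ksObservables, fun _ => isHermitian_of_mem_ksObservables, ?_⟩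
  rintro Λ _ ⟨l⟩ ⟨ε, -, hε⟩
  have h_one_hot : ∀ t ∈ ksTriads, IsOneHot (fun v => ε (rayProj v) l) t := by
    rintro ⟨u, v, w⟩ ht
    have h_triad := isOrthogonalTriad_of_mem_ksTriads _ ht
    obtain ⟨-, hv, hw, -, -, hvw⟩ := id h_triad
    exact isOneHot_of_noncontextual (S := ksObservables) (v := fun O => ε O l)
      (fun O hOS hO g hg => congr_fun (hε O hOS hO g hg) l)
      h_triad.sum_rayProj (rayProj_mul_self hv) (rayProj_mul_self hw)
      (rayProj_mul_eq_zero hvw) (rayProj_mul_eq_zero ((dotProduct_comm _ _).trans hvw))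
      (isHermitian_triadObservable (u, v, w)) (.inl rfl) (.inr ⟨_, ht, .inl rfl⟩)
      (.inr ⟨_, ht, .inr (.inl rfl)⟩) (.inr ⟨_, ht, .inr (.inr (.inl rfl))⟩)
      (.inr ⟨_, ht, .inr (.inr (.inr rfl))⟩)
  have h_col := colourable_of_isOneHot _ ksTriads [] [] h_one_hot (by simp) (by simp)
  simp [colourable_ksTriads] at h_col
end

section
/- There exists a finite set 𝒮 of Hermitian 3×3 complex matrices that admits no valuation, i.e., there is no function v : 𝒮 → ℝ satisfying both (i) the spectrum rule: v(O) is an eigenvalue of O for every O ∈ 𝒮, and (ii) the functional composition principle (FUNC): v(g(O)) = g(v(O)) whenever O ∈ 𝒮, g : ℝ → ℝ, and g(O) ∈ 𝒮. -/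
open Matrix

/-- Three nonzero, pairwise orthogonal integer vectors with coordinates in `[-5, 5]`. -/
def IsTriad (u v w : Fin 3 → ℤ) : Prop :=
  (∀ i, -5 ≤ u i ∧ u i ≤ 5) ∧ (∀ i, -5 ≤ v i ∧ v i ≤ 5) ∧ (∀ i, -5 ≤ w i ∧ w i ≤ 5) ∧
    u ≠ 0 ∧ v ≠ 0 ∧ w ≠ 0 ∧ u ⬝ᵥ v = 0 ∧ u ⬝ᵥ w = 0 ∧ v ⬝ᵥ w = 0

instance (u v w : Fin 3 → ℤ) : Decidable (IsTriad u v w) := by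
  unfold IsTriad
  infer_instance

/-- There is no Kochen–Specker colouring of the integer vectors with coordinates in `[-5, 5]`. -/
theorem not_exactly_one_of_triad (χ : (Fin 3 → ℤ) → Prop)
    (h : ∀ u v w, IsTriad u v w →
      (χ u ∨ χ v ∨ χ w) ∧ ¬(χ u ∧ χ v) ∧ ¬(χ u ∧ χ w) ∧ ¬(χ v ∧ χ w)) : False := by
  have h1 := h ![0, 0, 1] ![0, 1, 0] ![1, 0, 0] (by decide)
  have h2 := h ![0, 0, 1] ![1, -2, 0] ![2, 1, 0] (by decide)
  have h3 := h ![0, 0, 1] ![1, -1, 0] ![1, 1, 0] (by decide)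
  have h4 := h ![0, 0, 1] ![1, 2, 0] ![2, -1, 0] (by decide)
  have h5 := h ![0, 1, -2] ![0, 2, 1] ![1, 0, 0] (by decide)
  have h6 := h ![0, 1, -2] ![1, -2, -1] ![5, 2, 1] (by decide)
  have h7 := h ![0, 1, -2] ![1, 2, 1] ![5, -2, -1] (by decide)
  have h8 := h ![0, 1, -1] ![0, 1, 1] ![1, 0, 0] (by decide)
  have h9 := h ![0, 1, -1] ![1, -1, -1] ![2, 1, 1] (by decide)
  have h10 := h ![0, 1, -1] ![1, 1, 1] ![2, -1, -1] (by decide)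
  have h11 := h ![0, 1, 0] ![1, 0, -2] ![2, 0, 1] (by decide)
  have h12 := h ![0, 1, 0] ![1, 0, -1] ![1, 0, 1] (by decide)
  have h13 := h ![0, 1, 1] ![1, -1, 1] ![2, 1, -1] (by decide)
  have h14 := h ![0, 1, 1] ![1, 1, -1] ![2, -1, 1] (by decide)
  have h15 := h ![0, 1, 2] ![0, 2, -1] ![1, 0, 0] (by decide)
  have h16 := h ![0, 1, 2] ![1, -2, 1] ![5, 2, -1] (by decide)
  have h17 := h ![0, 1, 2] ![1, 2, -1] ![5, -2, 1] (by decide)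
  have h18 := h ![0, 2, -1] ![1, -1, -2] ![5, 1, 2] (by decide)
  have h19 := h ![0, 2, -1] ![1, 1, 2] ![5, -1, -2] (by decide)
  have h20 := h ![0, 2, 1] ![1, 1, -2] ![5, -1, 2] (by decide)
  have h21 := h ![1, -5, -2] ![1, 1, -2] ![2, 0, 1] (by decide)
  have h22 := h ![1, -2, -5] ![1, -2, 1] ![2, 1, 0] (by decide)
  have h23 := h ![1, -2, -1] ![1, 0, 1] ![1, 1, -1] (by decide)
  have h24 := h ![1, -2, 0] ![2, 1, -5] ![2, 1, 1] (by decide)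
  have h25 := h ![1, -2, 1] ![1, 0, -1] ![1, 1, 1] (by decide)
  have h26 := h ![1, -1, -2] ![1, -1, 1] ![1, 1, 0] (by decide)
  have h27 := h ![1, -1, -2] ![1, 5, -2] ![2, 0, 1] (by decide)
  have h28 := h ![1, -1, -1] ![1, -1, 2] ![1, 1, 0] (by decide)
  have h29 := h ![1, -1, -1] ![1, 0, 1] ![1, 2, -1] (by decide)
  have h30 := h ![1, -1, 0] ![1, 1, -2] ![1, 1, 1] (by decide)
  have h31 := h ![1, -1, 0] ![1, 1, -1] ![1, 1, 2] (by decide)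
  have h32 := h ![1, -1, 1] ![1, 0, -1] ![1, 2, 1] (by decide)
  have h33 := h ![1, 0, -2] ![2, -5, 1] ![2, 1, 1] (by decide)
  have h34 := h ![1, 0, -2] ![2, -1, 1] ![2, 5, 1] (by decide)
  have h35 := h ![1, 2, -5] ![1, 2, 1] ![2, -1, 0] (by decide)
  have h36 := h ![1, 2, -1] ![1, 2, 5] ![2, -1, 0] (by decide)
  have h37 := h ![1, 2, 0] ![2, -1, -5] ![2, -1, 1] (by decide)
  clear h
  grind

/-- The orthogonal projection of `ℂ³` onto the line spanned by an integer vector. -/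
noncomputable def lineProj (u : Fin 3 → ℤ) : M3 :=
  ((u ⬝ᵥ u : ℤ) : ℂ)⁻¹ • vecMulVec (fun i ↦ (u i : ℂ)) (fun i ↦ (u i : ℂ))

theorem lineProj_isHermitian (u : Fin 3 → ℤ) : (lineProj u).IsHermitian := by
  ext i j
  simp [lineProj, vecMulVec_apply, mul_comm]

theorem lineProj_mul_self (u : Fin 3 → ℤ) : lineProj u * lineProj u = lineProj u := by
  by_cases hu : u ⬝ᵥ u = 0
  · simp [lineProj, hu]
  · have hc : ((u ⬝ᵥ u : ℤ) : ℂ) ≠ 0 := mod_cast hu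
    have hd : (fun i ↦ (u i : ℂ)) ⬝ᵥ (fun i ↦ (u i : ℂ)) = ((u ⬝ᵥ u : ℤ) : ℂ) := by
      simp [dotProduct]
    rw [lineProj, smul_mul_smul_comm, vecMulVec_mul_vecMulVec, hd, vecMulVec_smul, smul_smul,
      mul_assoc, inv_mul_cancel₀ hc, mul_one]

theorem lineProj_mul_of_dotProduct_eq_zero {u v : Fin 3 → ℤ} (h : u ⬝ᵥ v = 0) :
    lineProj u * lineProj v = 0 := by
  have hd : (fun i ↦ (u i : ℂ)) ⬝ᵥ (fun i ↦ (v i : ℂ)) = ((u ⬝ᵥ v : ℤ) : ℂ) := by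
    simp [dotProduct]
  rw [lineProj, lineProj, smul_mul_smul_comm, vecMulVec_mul_vecMulVec, hd, h]
  simp

theorem lineProj_add_add_eq_one {u v w : Fin 3 → ℤ} (hu : u ≠ 0) (hv : v ≠ 0) (hw : w ≠ 0)
    (huv : u ⬝ᵥ v = 0) (huw : u ⬝ᵥ w = 0) (hvw : v ⬝ᵥ w = 0) :
    lineProj u + lineProj v + lineProj w = 1 := by
  let M : M3 := (of ![u, v, w]).map (fun x : ℤ ↦ (x : ℂ))
  let d : Fin 3 → ℂ := ![((u ⬝ᵥ u : ℤ) : ℂ)⁻¹, ((v ⬝ᵥ v : ℤ) : ℂ)⁻¹, ((w ⬝ᵥ w : ℤ) : ℂ)⁻¹]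
  have hu' : ((u ⬝ᵥ u : ℤ) : ℂ) ≠ 0 := mod_cast mt dotProduct_self_eq_zero.1 hu
  have hv' : ((v ⬝ᵥ v : ℤ) : ℂ) ≠ 0 := mod_cast mt dotProduct_self_eq_zero.1 hv
  have hw' : ((w ⬝ᵥ w : ℤ) : ℂ) ≠ 0 := mod_cast mt dotProduct_self_eq_zero.1 hw
  have hM : M * Mᵀ = diagonal ![((u ⬝ᵥ u : ℤ) : ℂ), ((v ⬝ᵥ v : ℤ) : ℂ), ((w ⬝ᵥ w : ℤ) : ℂ)] := by
    have hvu := (dotProduct_comm v u).trans huv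
    have hwu := (dotProduct_comm w u).trans huw
    have hwv := (dotProduct_comm w v).trans hvw
    have key (i j : Fin 3) : (M * Mᵀ) i j = ((![u, v, w] i ⬝ᵥ ![u, v, w] j : ℤ) : ℂ) := by
      simp [M, mul_apply, dotProduct]
    ext i j
    rw [key]
    fin_cases i <;> fin_cases j <;> simp [*]
  have h1 : M * (Mᵀ * diagonal d) = 1 := by
    rw [← Matrix.mul_assoc, hM, diagonal_mul_diagonal, ← diagonal_one]
    congr 1
    ext i
    fin_cases i <;> simp [d, hu', hv', hw']
  rw [← mul_eq_one_comm.1 h1]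
  ext i j
  simp [lineProj, M, d, mul_apply, vecMulVec_apply, Fin.sum_univ_three]
  ring

/-- An observable with eigenlines spanned by `u`, `v` (eigenvalues `1`, `-1`), whose kernel is the
orthogonal complement. -/
noncomputable def lineDiff (u v : Fin 3 → ℤ) : M3 := lineProj u - lineProj v

theorem lineDiff_isHermitian (u v : Fin 3 → ℤ) : (lineDiff u v).IsHermitian :=
  (lineProj_isHermitian u).sub (lineProj_isHermitian v)

theorem lineDiff_sq {u v : Fin 3 → ℤ} (h : u ⬝ᵥ v = 0) :
    lineDiff u v ^ 2 = lineProj u + lineProj v := by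
  have h' : v ⬝ᵥ u = 0 := (dotProduct_comm v u).trans h
  rw [lineDiff, sq, sub_mul, mul_sub, mul_sub, lineProj_mul_self, lineProj_mul_self,
    lineProj_mul_of_dotProduct_eq_zero h, lineProj_mul_of_dotProduct_eq_zero h']
  abel

theorem Matrix.IsHermitian.cfc_quadratic {A : M3} (hA : A.IsHermitian) (a b c : ℝ) :
    hA.cfc (fun x ↦ a * x ^ 2 + b * x + c) = a • A ^ 2 + b • A + c • (1 : M3) := by
  have h := cfc_polynomial
    (Polynomial.C a * Polynomial.X ^ 2 + Polynomial.C b * Polynomial.X + Polynomial.C c) A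
    hA.isSelfAdjoint
  rw [hA.cfc_eq] at h
  simpa [Algebra.smul_def, Polynomial.eval_add, Polynomial.eval_mul, Polynomial.eval_pow] using! h

/-- There exists a finite set `𝒮` of Hermitian 3×3 complex matrices that
admits no valuation: no function `v : 𝒮 → ℝ` satisfies both (i) the spectrum rule, `v(O)`
is an eigenvalue of `O` for every `O ∈ 𝒮`, and (ii) the functional composition principle,
`v(g(O)) = g(v(O))` whenever `O ∈ 𝒮`, `g : ℝ → ℝ` and `g(O) ∈ 𝒮`, where
`g(O) = Σ_k g(λ_k) p_k` is the functional calculus. -/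
theorem exists_finite_set_without_valuation :
    ∃ 𝒮 : Set M3, 𝒮.Finite ∧ (∀ O ∈ 𝒮, O.IsHermitian) ∧
      ¬ ∃ v : M3 → ℝ,
        (∀ O ∈ 𝒮, ((v O : ℂ)) ∈ spectrum ℂ O) ∧
        (∀ O ∈ 𝒮, ∀ (hO : O.IsHermitian) (g : ℝ → ℝ),
          hO.cfc g ∈ 𝒮 → v (hO.cfc g) = g (v O)) := by
  let B : Set (Fin 3 → ℤ) := Set.Icc (fun _ ↦ -5) (fun _ ↦ 5)
  have hB : B.Finite := Set.finite_Icc _ _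
  refine ⟨lineProj '' B ∪ Set.image2 lineDiff B B, (hB.image _).union (hB.image2 _ hB), ?_, ?_⟩
  · rintro _ (⟨u, -, rfl⟩ | ⟨u, -, v, -, rfl⟩)
    exacts [lineProj_isHermitian u, lineDiff_isHermitian u v]
  rintro ⟨val, hspec, hfunc⟩
  refine not_exactly_one_of_triad (fun u ↦ val (lineProj u) = 1) fun u v w ht ↦ ?_
  obtain ⟨hu, hv, hw, hu0, hv0, hw0, huv, huw, hvw⟩ := ht
  have mem_box {x : Fin 3 → ℤ} (hx : ∀ i, -5 ≤ x i ∧ x i ≤ 5) : x ∈ B :=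
    ⟨fun i ↦ (hx i).1, fun i ↦ (hx i).2⟩
  have zero_or_one {x : Fin 3 → ℤ} (hx : x ∈ B) :
      val (lineProj x) = 0 ∨ val (lineProj x) = 1 := by
    have h := IsIdempotentElem.spectrum_subset ℂ (lineProj_mul_self x)
      (hspec _ (.inl ⟨x, hx, rfl⟩))
    simpa using h
  have val_eq {x : Fin 3 → ℤ} (hx : x ∈ B) (a b c : ℝ)
      (h : a • lineDiff u v ^ 2 + b • lineDiff u v + c • (1 : M3) = lineProj x) :
      val (lineProj x) = a * val (lineDiff u v) ^ 2 + b * val (lineDiff u v) + c := by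
    have hcfc := ((lineDiff_isHermitian u v).cfc_quadratic a b c).trans h
    have hf := hfunc (lineDiff u v) (.inr ⟨u, mem_box hu, v, mem_box hv, rfl⟩)
      (lineDiff_isHermitian u v) (fun x ↦ a * x ^ 2 + b * x + c)
    rw [hcfc] at hf
    exact hf (.inl ⟨x, hx, rfl⟩)
  have hvalu := val_eq (mem_box hu) (1 / 2) (1 / 2) 0 (by
    rw [lineDiff_sq huv, lineDiff]
    module)
  have hvalv := val_eq (mem_box hv) (1 / 2) (-1 / 2) 0 (by
    rw [lineDiff_sq huv, lineDiff]
    module)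
  have hvalw := val_eq (mem_box hw) (-1) 0 1 (by
    rw [lineDiff_sq huv, ← lineProj_add_add_eq_one hu0 hv0 hw0 huv huw hvw]
    module)
  have hsum : val (lineProj u) + val (lineProj v) + val (lineProj w) = 1 := by
    rw [hvalu, hvalv, hvalw]
    ring
  have hu01 := zero_or_one (mem_box hu)
  have hv01 := zero_or_one (mem_box hv)
  have hw01 := zero_or_one (mem_box hw)
  clear hvalu hvalv hvalw
  grind
end

section
/- There exists a finite set V of unit vectors in ℝ³ that admits no Kochen–Specker colouring: there is no function f : V → {0, 1} such that (a) no two orthogonal vectors of V are both assigned the value 1, and (b) in every triple of pairwise orthogonal unit vectors of V, at least one vector is assigned the value 1 (hence exactly one). Such a set V is called a Kochen–Specker set. -/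
open scoped RealInnerProductSpace

namespace KochenSpecker

/-- The nonzero integer vectors with coordinates of absolute value at most `2`. -/
noncomputable def box : Finset (ℤ × ℤ × ℤ) :=
  (Finset.Icc (-2) 2 ×ˢ Finset.Icc (-2) 2 ×ˢ Finset.Icc (-2) 2).erase 0

/-- The standard inner product on integer vectors. -/
def dot (u v : ℤ × ℤ × ℤ) : ℤ :=
  u.1 * v.1 + u.2.1 * v.2.1 + u.2.2 * v.2.2

/-- A Kochen–Specker colouring of `box`, where `g v` means that `v` has the value `1`. -/
structure IsColouring (g : ℤ × ℤ × ℤ → Prop) : Prop where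
  not_both : ∀ u ∈ box, ∀ v ∈ box, dot u v = 0 → ¬(g u ∧ g v)
  exists_of_triple : ∀ u ∈ box, ∀ v ∈ box, ∀ w ∈ box,
    dot u v = 0 → dot u w = 0 → dot v w = 0 → g u ∨ g v ∨ g w

namespace IsColouring

variable {g : ℤ × ℤ × ℤ → Prop}

theorem not_of (hg : IsColouring g) {u : ℤ × ℤ × ℤ} (h : g u) (v : ℤ × ℤ × ℤ)
    (hu : u ∈ box := by decide) (hv : v ∈ box := by decide)
    (huv : dot u v = 0 := by decide) : ¬g v :=
  fun h' => hg.not_both u hu v hv huv ⟨h, h'⟩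

theorem of_not_of_not (hg : IsColouring g) {u v : ℤ × ℤ × ℤ} (h : ¬g u) (h' : ¬g v)
    (w : ℤ × ℤ × ℤ)
    (hu : u ∈ box := by decide) (hv : v ∈ box := by decide) (hw : w ∈ box := by decide)
    (huv : dot u v = 0 := by decide) (huw : dot u w = 0 := by decide)
    (hvw : dot v w = 0 := by decide) : g w :=
  ((hg.exists_of_triple u hu v hv w hw huv huw hvw).resolve_left h).resolve_left h'

theorem comp (hg : IsColouring g) (σ : ℤ × ℤ × ℤ → ℤ × ℤ × ℤ)
    (hσ : ∀ v ∈ box, σ v ∈ box) (hdot : ∀ u v, dot (σ u) (σ v) = dot u v) :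
    IsColouring (g ∘ σ) where
  not_both u hu v hv huv :=
    hg.not_both _ (hσ u hu) _ (hσ v hv) ((hdot u v).trans huv)
  exists_of_triple u hu v hv w hw huv huw hvw :=
    hg.exists_of_triple _ (hσ u hu) _ (hσ v hv) _ (hσ w hw)
      ((hdot u v).trans huv) ((hdot u w).trans huw) ((hdot v w).trans hvw)

/-- The values of `(1, 0, 0)` and `(1, 1, 0)`, which enclose an angle of `π / 4`,
cannot both be `1`. -/
theorem not_diagonal (hg : IsColouring g) (h₁ : g (1, 0, 0)) : ¬g (1, 1, 0) := by
  intro h₂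
  have h₃ : ¬g (0, 1, 0) := hg.not_of h₁ _
  have h₄ : ¬g (1, -1, 0) := hg.not_of h₂ _
  have key₁ : g (1, 1, 1) := by
    have a : g (2, 1, 1) := hg.of_not_of_not (hg.not_of h₁ (0, 1, -1)) (hg.not_of h₂ (1, -1, -1)) _
    have b : g (2, 0, 1) := hg.of_not_of_not h₃ (hg.not_of a (1, 0, -2)) _
    exact hg.of_not_of_not h₄ (hg.not_of b (1, 1, -2)) _
  have key₂ : g (1, 1, -1) := by
    have a : g (2, 1, -1) := hg.of_not_of_not (hg.not_of h₁ (0, 1, 1)) (hg.not_of h₂ (1, -1, 1)) _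
    have b : g (2, 0, -1) := hg.of_not_of_not h₃ (hg.not_of a (1, 0, 2)) _
    exact hg.of_not_of_not h₄ (hg.not_of b (1, 1, 2)) _
  exact (hg.not_of key₂ (1, 0, 1)) (hg.of_not_of_not h₃ (hg.not_of key₁ (1, 0, -1)) _)

end IsColouring

theorem not_isColouring (g : ℤ × ℤ × ℤ → Prop) : ¬IsColouring g := by
  intro hg
  have diag (σ : ℤ × ℤ × ℤ → ℤ × ℤ × ℤ)
      (hσ : ∀ v ∈ box, σ v ∈ box := by simp [box, Prod.ext_iff]; lia)
      (hdot : ∀ u v, dot (σ u) (σ v) = dot u v := by intro u v; simp only [dot]; ring) :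
      g (σ (1, 0, 0)) → ¬g (σ (1, 1, 0)) :=
    (hg.comp σ hσ hdot).not_diagonal
  have h₁ : ¬g (1, 0, 0) := fun h =>
    (diag fun v => (v.1, -v.2.1, v.2.2)) h
      (hg.of_not_of_not (hg.not_diagonal h) (hg.not_of h (0, 0, 1)) _)
  have h₂ : ¬g (0, 1, 1) := fun h =>
    have h' : ¬g (0, 1, 0) := fun h' => (diag fun v => (v.2.2, v.1, v.2.1)) h' h
    (diag fun v => (v.2.2, v.2.1, v.1)) (hg.of_not_of_not h₁ h' _) h
  have h₃ : ¬g (0, 1, -1) := fun h =>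
    have h' : ¬g (0, 1, 0) := fun h' => (diag fun v => (v.2.2, v.1, -v.2.1)) h' h
    (diag fun v => (v.2.2, v.2.1, -v.1)) (hg.of_not_of_not h₁ h' _) h
  exact h₃ (hg.of_not_of_not h₁ h₂ _)

/-- The unit vector of `ℝ³` in the direction of an integer vector (and `0` for the zero vector). -/
noncomputable def direction (v : ℤ × ℤ × ℤ) : EuclideanSpace ℝ (Fin 3) :=
  NormedSpace.normalize !₂[(v.1 : ℝ), (v.2.1 : ℝ), (v.2.2 : ℝ)]

theorem norm_direction {v : ℤ × ℤ × ℤ} (hv : v ≠ 0) : ‖direction v‖ = 1 := by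
  refine NormedSpace.norm_normalize fun h => hv ?_
  have h₀ := congrArg (· 0) h
  have h₁ := congrArg (· 1) h
  have h₂ := congrArg (· 2) h
  simp at h₀ h₁ h₂
  ext <;> simpa

theorem inner_direction {u v : ℤ × ℤ × ℤ} (h : dot u v = 0) :
    ⟪direction u, direction v⟫ = 0 := by
  have h' : (u.1 * v.1 + u.2.1 * v.2.1 + u.2.2 * v.2.2 : ℝ) = 0 := by exact_mod_cast h
  simp only [direction, NormedSpace.normalize, real_inner_smul_left, real_inner_smul_right]
  simp only [PiLp.inner_apply, Fin.sum_univ_three]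
  simp [mul_comm] at h' ⊢
  simp [h']

end KochenSpecker

open KochenSpecker in
/-- There exists a finite set `V` of unit vectors in ℝ³ admitting no
Kochen–Specker colouring: there is no `f : V → {0, 1}` such that (a) no two orthogonal
vectors of `V` are both assigned the value 1, and (b) every triple of pairwise orthogonal
unit vectors of `V` contains at least one (hence exactly one) vector assigned the value 1.
Such a `V` is a Kochen–Specker set. -/
theorem exists_kochen_specker_set :
    ∃ V : Finset (EuclideanSpace ℝ (Fin 3)),
      (∀ v ∈ V, ‖v‖ = 1) ∧
      ¬ ∃ f : EuclideanSpace ℝ (Fin 3) → Fin 2,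
        (∀ u ∈ V, ∀ v ∈ V, ⟪u, v⟫ = 0 → ¬(f u = 1 ∧ f v = 1)) ∧
        (∀ u ∈ V, ∀ v ∈ V, ∀ w ∈ V,
          ⟪u, v⟫ = 0 → ⟪u, w⟫ = 0 → ⟪v, w⟫ = 0 →
          (f u = 1 ∨ f v = 1 ∨ f w = 1)) := by
  classical
  refine ⟨box.image direction, ?_, ?_⟩
  · simp only [Finset.forall_mem_image]
    exact fun v hv => norm_direction (Finset.ne_of_mem_erase hv)
  · rintro ⟨f, hf₁, hf₂⟩
    simp only [Finset.forall_mem_image] at hf₁ hf₂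
    exact not_isColouring (fun v => f (direction v) = 1)
      { not_both := fun u hu v hv huv => hf₁ hu hv (inner_direction huv)
        exists_of_triple := fun u hu v hv w hw huv huw hvw =>
          hf₂ hu hv hw (inner_direction huv) (inner_direction huw) (inner_direction hvw) }
end

section
/- Let d ≥ 1, let Λ be a nonempty measurable space, and let ε be a map assigning to every Hermitian d×d complex matrix O a function ε(O) : Λ → ℝ such that ε(g(O)) = g ∘ ε(O) for every Hermitian O and every g : ℝ → ℝ. Then for every λ ∈ Λ: ε(0)(λ) = 0, ε(1)(λ) = 1 (where 1 denotes the identity matrix), ε(p)(λ) ∈ {0, 1} for every orthogonal projection p, and ε(p + q)(λ) = ε(p)(λ) + ε(q)(λ) for all orthogonal projections p, q with pq = 0. In particular, ε maps each projection p to the indicator function of a subset Λ_p ⊆ Λ, with Λ_{p+q} the disjoint union of Λ_p and Λ_q whenever pq = 0. -/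
open Matrix

namespace Matrix.IsHermitian

variable {n : Type*} [Fintype n] [DecidableEq n] {A : Matrix n n ℂ}

/-- The functional calculus of a Hermitian matrix agrees with polynomial evaluation. -/
theorem cfc_polynomial_eval (hA : A.IsHermitian) (P : Polynomial ℝ) :
    hA.cfc (fun x => P.eval x) = Polynomial.aeval A P := by
  rw [← hA.cfc_eq]
  exact cfc_polynomial P A hA.isSelfAdjoint

theorem cfc_const (hA : A.IsHermitian) (c : ℝ) :
    hA.cfc (fun _ => c) = algebraMap ℝ (Matrix n n ℂ) c := by
  simpa using hA.cfc_polynomial_eval (Polynomial.C c)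

/-- Quadratic polynomials in a Hermitian matrix. -/
theorem cfc_quadratic_s10 (hA : A.IsHermitian) (a b : ℝ) :
    hA.cfc (fun x => a * x + b * (x * x)) = a • A + b • (A * A) := by
  have h := hA.cfc_polynomial_eval
    (Polynomial.C a * Polynomial.X + Polynomial.C b * (Polynomial.X * Polynomial.X))
  simp only [Polynomial.eval_add, Polynomial.eval_mul, Polynomial.eval_C, Polynomial.eval_X,
    map_add, map_mul, Polynomial.aeval_C, Polynomial.aeval_X] at h
  rw [h, Algebra.smul_def, Algebra.smul_def]

end Matrix.IsHermitian

/-- Given `d ≥ 1`, a nonempty measurable space `Λ` and a map `ε`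
assigning to every Hermitian d×d complex matrix `O` a function `ε(O) : Λ → ℝ` with
`ε(g(O)) = g ∘ ε(O)` for every Hermitian `O` and every `g : ℝ → ℝ` (functional calculus
`g(O) = Σ_k g(λ_k) p_k`), for every `λ ∈ Λ` we have: `ε(0)(λ) = 0`, `ε(1)(λ) = 1`,
`ε(p)(λ) ∈ {0, 1}` for every orthogonal projection `p`, and
`ε(p + q)(λ) = ε(p)(λ) + ε(q)(λ)` for orthogonal projections `p, q` with `pq = 0`.
In particular, `ε` maps each projection `p` to the indicator function of the subset
`Λ_p = {λ | ε(p)(λ) = 1} ⊆ Λ`, and `Λ_{p+q}` is the disjoint union of `Λ_p` and `Λ_q`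
whenever `pq = 0`. -/
theorem embedding_orthomorphism_on_projections
    (d : ℕ) (hd : 1 ≤ d) (Λ : Type*) [MeasurableSpace Λ] [Nonempty Λ]
    (ε : Matrix (Fin d) (Fin d) ℂ → Λ → ℝ)
    (hKSNC : ∀ (O : Matrix (Fin d) (Fin d) ℂ) (hO : O.IsHermitian) (g : ℝ → ℝ),
      ε (hO.cfc g) = g ∘ ε O)
    (lam : Λ) :
    ε 0 lam = 0 ∧
    ε 1 lam = 1 ∧
    (∀ p : Matrix (Fin d) (Fin d) ℂ, p.IsHermitian → p * p = p →
      ε p lam = 0 ∨ ε p lam = 1) ∧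
    (∀ p q : Matrix (Fin d) (Fin d) ℂ, p.IsHermitian → q.IsHermitian →
      p * p = p → q * q = q → p * q = 0 →
      ε (p + q) lam = ε p lam + ε q lam) ∧
    (∀ p : Matrix (Fin d) (Fin d) ℂ, p.IsHermitian → p * p = p →
      ε p = Set.indicator {x : Λ | ε p x = 1} (fun _ => (1 : ℝ))) ∧
    (∀ p q : Matrix (Fin d) (Fin d) ℂ, p.IsHermitian → q.IsHermitian →
      p * p = p → q * q = q → p * q = 0 →
      Disjoint {x : Λ | ε p x = 1} {x : Λ | ε q x = 1} ∧
      {x : Λ | ε (p + q) x = 1} = {x : Λ | ε p x = 1} ∪ {x : Λ | ε q x = 1}) := by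
  have quad : ∀ O : Matrix (Fin d) (Fin d) ℂ, O.IsHermitian → ∀ (a b : ℝ) (x : Λ),
      ε (a • O + b • (O * O)) x = a * ε O x + b * (ε O x * ε O x) := by
    intro O hO a b x
    rw [← hO.cfc_quadratic_s10, hKSNC]
    rfl
  have zero_or_one : ∀ p : Matrix (Fin d) (Fin d) ℂ, p.IsHermitian → p * p = p →
      ∀ x, ε p x = 0 ∨ ε p x = 1 := by
    intro p hp hpp x
    have h := quad p hp 0 1 x
    simp only [zero_smul, one_smul, zero_add, hpp, zero_mul, one_mul] at h
    have h' : ε p x * (ε p x - 1) = 0 := by linarith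
    rcases mul_eq_zero.mp h' with h0 | h1
    · exact .inl h0
    · exact .inr (sub_eq_zero.mp h1)
  have additive : ∀ p q : Matrix (Fin d) (Fin d) ℂ, p.IsHermitian → q.IsHermitian →
      p * p = p → q * q = q → p * q = 0 → q * p = 0 →
      ∀ x, ε (p + q) x = ε p x + ε q x := by
    intro p q hp hq hpp hqq hpq hqp x
    have hO : (p + (2 : ℝ) • q).IsHermitian := by
      have h2 : (2 : ℝ) • q = q + q := two_smul ℝ q
      rw [h2]
      exact hp.add (hq.add hq)
    have hsq : (p + (2 : ℝ) • q) * (p + (2 : ℝ) • q) = p + (4 : ℝ) • q := by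
      simp only [add_mul, mul_add, smul_mul_assoc, mul_smul_comm, hpp, hqq, hpq, hqp]
      module
    have hP := quad _ hO 2 (-1) x
    have hQ := quad _ hO (-1 / 2) (1 / 2) x
    have hS := quad _ hO (3 / 2) (-1 / 2) x
    rw [hsq] at hP hQ hS
    rw [show (2 : ℝ) • (p + (2 : ℝ) • q) + (-1 : ℝ) • (p + (4 : ℝ) • q) = p by module] at hP
    rw [show (-1 / 2 : ℝ) • (p + (2 : ℝ) • q) + (1 / 2 : ℝ) • (p + (4 : ℝ) • q) = q by
      module] at hQ
    rw [show (3 / 2 : ℝ) • (p + (2 : ℝ) • q) + (-1 / 2 : ℝ) • (p + (4 : ℝ) • q) = p + q by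
      module] at hS
    linarith
  have comm_zero : ∀ p q : Matrix (Fin d) (Fin d) ℂ, p.IsHermitian → q.IsHermitian →
      p * q = 0 → q * p = 0 := by
    intro p q hp hq hpq
    simpa [conjTranspose_mul, hp.eq, hq.eq] using congrArg conjTranspose hpq
  have const : ∀ c : ℝ, ε (algebraMap ℝ _ c) lam = c := by
    intro c
    have h := hKSNC 0 isHermitian_zero (fun _ => c)
    rw [IsHermitian.cfc_const] at h
    exact congrFun h lam
  refine ⟨by simpa using const 0, by simpa using const 1,
    fun p hp hpp => zero_or_one p hp hpp lam,
    fun p q hp hq hpp hqq hpq =>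
      additive p q hp hq hpp hqq hpq (comm_zero p q hp hq hpq) lam, ?_, ?_⟩
  · intro p hp hpp
    funext x
    rcases zero_or_one p hp hpp x with h | h <;> simp [Set.indicator, h]
  · intro p q hp hq hpp hqq hpq
    have hqp := comm_zero p q hp hq hpq
    have hadd := additive p q hp hq hpp hqq hpq hqp
    have hsum := zero_or_one (p + q) (hp.add hq)
      (by simp [add_mul, mul_add, hpp, hqq, hpq, hqp])
    have hp01 := zero_or_one p hp hpp
    have hq01 := zero_or_one q hq hqq
    have not_both : ∀ x, ε p x = 1 → ε q x = 1 → False := by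
      intro x h1 h2
      rcases hsum x with h | h <;> linarith [hadd x]
    refine ⟨Set.disjoint_left.mpr not_both, ?_⟩
    ext x
    change ε (p + q) x = 1 ↔ ε p x = 1 ∨ ε q x = 1
    rcases hp01 x with h1 | h1 <;> rcases hq01 x with h2 | h2
    · simp [hadd x, h1, h2]
    · simp [hadd x, h1, h2]
    · simp [hadd x, h1, h2]
    · exact (not_both x h1 h2).elim
end

section
/- Let n ≥ 1 and let C be a set of Hermitian n×n complex matrices that is a unital commutative real subalgebra of the n×n complex matrices: C is a real linear subspace containing the identity matrix, closed under matrix multiplication, and all elements of C commute pairwise. Then there exists a Hermitian matrix O ∈ C such that C = C(O) := {h(O) : h : ℝ → ℝ}, i.e., every commutative subalgebra of Hermitian matrices is generated by a single self-adjoint operator under the functional calculus. -/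
open Matrix

open Polynomial in
theorem Matrix.aeval_mulVec_of_mulVec_eq_smul {m : Type*} [Fintype m] [DecidableEq m]
    {M : Matrix m m ℂ} {v : m → ℂ} {r : ℝ} (h : M *ᵥ v = r • v) (p : ℝ[X]) :
    aeval M p *ᵥ v = p.eval r • v := by
  induction p using Polynomial.induction_on' with
  | add p q hp hq => simp [add_mulVec, hp, hq, add_smul]
  | monomial k c =>
    have hpow : ∀ k : ℕ, (M ^ k) *ᵥ v = r ^ k • v := by
      intro k
      induction k with
      | zero => simp
      | succ k ih => rw [pow_succ', ← mulVec_mulVec, ih, mulVec_smul, h, smul_smul, pow_succ]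
    rw [aeval_monomial, eval_monomial, ← Algebra.smul_def, smul_mulVec, hpow, smul_smul]

/-- Two matrices agreeing on the joint eigenvectors of two commuting Hermitian matrices agree. -/
theorem Matrix.IsHermitian.ext_of_joint_eigenvectors {m : Type*} [Fintype m] [DecidableEq m]
    {A B M N : Matrix m m ℂ} (hA : A.IsHermitian) (hB : B.IsHermitian) (hAB : Commute A B)
    (h : ∀ (v : m → ℂ), ∀ a ∈ spectrum ℝ A, ∀ b ∈ spectrum ℝ B,
      A *ᵥ v = a • v → B *ᵥ v = b • v → M *ᵥ v = N *ᵥ v) : M = N := by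
  let Φ := toLpLinAlgEquiv (n := m) (R := ℂ) 2
  have hA' : (Φ A).IsSymmetric := isSymmetric_toEuclideanLin_iff.mpr hA
  have hB' : (Φ B).IsSymmetric := isSymmetric_toEuclideanLin_iff.mpr hB
  have key : ∀ {D : Matrix m m ℂ} (_ : (Φ D).IsSymmetric) {z : ℂ} {x : EuclideanSpace ℂ m},
      x ≠ 0 → x ∈ Module.End.eigenspace (Φ D) z →
      z.re ∈ spectrum ℝ D ∧ D *ᵥ x.ofLp = z.re • x.ofLp := by
    intro D hD z x hx hxz
    have hev : Module.End.HasEigenvalue (Φ D) z :=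
      Module.End.hasEigenvalue_of_hasEigenvector ⟨hxz, hx⟩
    have hz : (z.re : ℂ) = z := Complex.conj_eq_iff_re.mp (hD.conj_eigenvalue_eq_self hev)
    refine ⟨spectrum.of_algebraMap_mem ℂ ?_, ?_⟩
    · have := hev.mem_spectrum
      rw [AlgEquiv.spectrum_eq] at this
      simpa [hz] using this
    · have := congrArg WithLp.ofLp (Module.End.mem_eigenspace_iff.mp hxz)
      rw [← hz] at this
      exact this
  apply Φ.injective
  rw [← sub_eq_zero, ← LinearMap.ker_eq_top, eq_top_iff,
    ← hA'.iSup_iSup_eigenspace_inf_eigenspace_eq_top_of_commute hB' (hAB.map Φ)]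
  refine iSup_le fun z ↦ iSup_le fun w ↦ fun x ⟨hxz, hxw⟩ ↦ ?_
  rcases eq_or_ne x 0 with rfl | hx
  · exact zero_mem _
  · obtain ⟨ha, hAx⟩ := key hA' hx hxz
    obtain ⟨hb, hBx⟩ := key hB' hx hxw
    rw [LinearMap.mem_ker, LinearMap.sub_apply, sub_eq_zero]
    exact WithLp.ofLp_injective 2 (h x.ofLp _ ha _ hb hAx hBx)

theorem Set.Finite.exists_injOn_add_mul {s : Set (ℝ × ℝ)} (hs : s.Finite) :
    ∃ t : ℝ, t ≠ 0 ∧ s.InjOn fun x ↦ x.1 + t * x.2 := by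
  obtain ⟨t, ht⟩ := (((hs.prod hs).image
    fun y ↦ (y.2.1 - y.1.1) / (y.1.2 - y.2.2)).insert 0).exists_notMem
  simp only [Set.mem_insert_iff, not_or] at ht
  refine ⟨t, ht.1, fun x hx y hy hxy ↦ ?_⟩
  dsimp only at hxy
  by_cases h : x.2 = y.2
  · exact Prod.ext (by rw [h] at hxy; linarith) h
  · refine absurd ⟨(x, y), ⟨hx, hy⟩, ?_⟩ ht.2
    have : x.2 - y.2 ≠ 0 := sub_ne_zero.mpr h
    dsimp only
    rw [div_eq_iff this]
    linarith

/-- Two commuting Hermitian matrices are polynomials in a common linear combination. -/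
theorem Matrix.IsHermitian.exists_mem_adjoin_add_smul {m : Type*} [Fintype m] [DecidableEq m]
    {A B : Matrix m m ℂ} (hA : A.IsHermitian) (hB : B.IsHermitian) (hAB : Commute A B) :
    ∃ t : ℝ, A ∈ Algebra.adjoin ℝ {A + t • B} ∧ B ∈ Algebra.adjoin ℝ {A + t • B} := by
  have hfin : (spectrum ℝ A ×ˢ spectrum ℝ B).Finite :=
    A.finite_real_spectrum.prod B.finite_real_spectrum
  obtain ⟨t, ht, hinj⟩ := hfin.exists_injOn_add_mul
  have hmem : A ∈ Algebra.adjoin ℝ {A + t • B} := by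
    rw [Algebra.adjoin_singleton_eq_range_aeval]
    refine ⟨Lagrange.interpolate hfin.toFinset (fun x ↦ x.1 + t * x.2) Prod.fst,
      hA.ext_of_joint_eigenvectors hB hAB fun v a ha b hb hAv hBv ↦ ?_⟩
    have hv : (A + t • B) *ᵥ v = (a + t * b) • v := by
      rw [add_mulVec, smul_mulVec, hAv, hBv, smul_smul, add_smul]
    have hnode := Lagrange.eval_interpolate_at_node (s := hfin.toFinset)
      (v := fun x : ℝ × ℝ ↦ x.1 + t * x.2) Prod.fst (by simpa using hinj)
      (i := (a, b)) (by simpa using ⟨ha, hb⟩)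
    exact (aeval_mulVec_of_mulVec_eq_smul hv _).trans (by rw [hnode, hAv])
  refine ⟨t, hmem, ?_⟩
  have hB' : B = t⁻¹ • ((A + t • B) - A) := by simp [smul_smul, ht]
  have := Subalgebra.smul_mem _ (sub_mem (Algebra.self_mem_adjoin_singleton ℝ (A + t • B)) hmem) t⁻¹
  rwa [← hB'] at this

/-- The functions of a Hermitian matrix are its real polynomials. -/
theorem Matrix.IsHermitian.mem_adjoin_iff_exists_cfc {m : Type*} [Fintype m] [DecidableEq m]
    {O : Matrix m m ℂ} (hO : O.IsHermitian) {A : Matrix m m ℂ} :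
    A ∈ Algebra.adjoin ℝ {O} ↔ ∃ h : ℝ → ℝ, A = hO.cfc h := by
  rw [Algebra.adjoin_singleton_eq_range_aeval]
  constructor
  · rintro ⟨p, rfl⟩
    exact ⟨p.eval, by rw [← hO.cfc_eq, cfc_polynomial p O hO.isSelfAdjoint]; rfl⟩
  · rintro ⟨h, rfl⟩
    have hfin := O.finite_real_spectrum
    refine ⟨Lagrange.interpolate hfin.toFinset id h, ?_⟩
    rw [← hO.cfc_eq]
    refine (cfc_polynomial _ O hO.isSelfAdjoint).symm.trans (cfc_congr fun x hx ↦ ?_)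
    exact Lagrange.eval_interpolate_at_node (v := id) h (Set.injOn_id _) (by simpa using hx)

/-- A commutative real algebra of Hermitian matrices is generated by one of its elements. -/
theorem Subalgebra.exists_adjoin_singleton_eq_of_isHermitian {m : Type*} [Fintype m]
    [DecidableEq m] (S : Subalgebra ℝ (Matrix m m ℂ)) (hS : ∀ A ∈ S, A.IsHermitian)
    (hcomm : ∀ A ∈ S, ∀ B ∈ S, Commute A B) : ∃ O ∈ S, Algebra.adjoin ℝ {O} = S := by
  obtain ⟨_, ⟨O, hO, rfl⟩, hmax⟩ := WellFounded.has_min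
    (wellFounded_gt (α := Submodule ℝ (Matrix m m ℂ)))
    ((fun O ↦ Subalgebra.toSubmodule (Algebra.adjoin ℝ {O})) '' (S : Set (Matrix m m ℂ)))
    ⟨_, 1, S.one_mem, rfl⟩
  refine ⟨O, hO, le_antisymm (Algebra.adjoin_le (by simpa using hO)) fun A hA ↦ ?_⟩
  obtain ⟨t, hAt, hOt⟩ :=
    (hS A hA).exists_mem_adjoin_add_smul (hS O hO) (hcomm A hA O hO)
  have hle : Algebra.adjoin ℝ {O} ≤ Algebra.adjoin ℝ {A + t • O} :=
    Algebra.adjoin_le (by simpa using hOt)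
  by_contra hAO
  exact hmax _ ⟨A + t • O, S.add_mem hA (S.smul_mem hO t), rfl⟩
    (lt_of_le_of_ne hle fun h ↦ hAO (Subalgebra.toSubmodule_injective h ▸ hAt))

/-- Let `C` be a set of Hermitian n×n complex matrices forming a unital
commutative real subalgebra of the n×n complex matrices: `C` contains the identity, is
closed under addition, real scalar multiplication and matrix multiplication, and all its
elements commute pairwise. Then `C` is generated by a single self-adjoint operator under
the functional calculus: there is `O ∈ C` with `C = C(O) = {h(O) : h : ℝ → ℝ}`, where
`h(O) = Σ_k h(λ_k) p_k`. -/
theorem commutative_subalgebra_singly_generated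
    (n : ℕ) (hn : 1 ≤ n) (C : Set (Matrix (Fin n) (Fin n) ℂ))
    (hherm : ∀ A ∈ C, A.IsHermitian)
    (hone : (1 : Matrix (Fin n) (Fin n) ℂ) ∈ C)
    (hadd : ∀ A ∈ C, ∀ B ∈ C, A + B ∈ C)
    (hsmul : ∀ r : ℝ, ∀ A ∈ C, (r : ℂ) • A ∈ C)
    (hmul : ∀ A ∈ C, ∀ B ∈ C, A * B ∈ C)
    (hcomm : ∀ A ∈ C, ∀ B ∈ C, A * B = B * A) :
    ∃ O ∈ C, ∃ hO : O.IsHermitian,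
      C = {A : Matrix (Fin n) (Fin n) ℂ | ∃ h : ℝ → ℝ, A = hO.cfc h} := by
  let S : Subalgebra ℝ (Matrix (Fin n) (Fin n) ℂ) :=
    { carrier := C
      mul_mem' := fun {A B} hA hB ↦ hmul A hA B hB
      add_mem' := fun {A B} hA hB ↦ hadd A hA B hB
      algebraMap_mem' := fun r ↦ by
        simpa [Algebra.algebraMap_eq_smul_one] using hsmul r 1 hone }
  obtain ⟨O, hO, hS⟩ := S.exists_adjoin_singleton_eq_of_isHermitian hherm hcomm
  refine ⟨O, hO, hherm O hO, Set.ext fun A ↦ ?_⟩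
  rw [Set.mem_ofPred_eq, ← (hherm O hO).mem_adjoin_iff_exists_cfc, hS]
  rfl
end
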